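/- arXiv:2204.00412 — 2 statements merged into one kernel-verified Lean document; each statement's English description precedes it below -/
import Mathlib

section
/- Let h ≥ 2 be an integer. For every multiplicative basis A of order h for ℤ⁺ (i.e., A ∈ MB_h), one has limsup_{x→∞} A(x) · (log x)^{1-1/h} / x > 1/e. -/
open Filter Real

/-- Counting function: `A(x) = |A ∩ {1,…,⌊x⌋}|`. -/
noncomputable def cntF (A : Set ℕ) (x : ℝ) : ℕ := (A ∩ Set.Icc 1 ⌊x⌋₊).ncard

/-- Multiplicative representation function of order `h`. -/
noncomputable def mulRep (h : ℕ) (A : Set ℕ) (n : ℕ) : ℕ :=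
  {f : Fin h → ℕ | (∀ i, f i ∈ A) ∧ ∏ i, f i = n}.ncard

/-- `A` is a multiplicative basis of order `h` for `ℤ⁺`. -/
def IsMB (h : ℕ) (A : Set ℕ) : Prop := ∀ n : ℕ, 1 ≤ n → 1 ≤ mulRep h A n

open MeasureTheory Set
open scoped ENNReal Nat

/-- A power of an infinite sum of extended nonnegative reals is the sum over tuples. -/
lemma tsum_prod_fin_eq_pow {T : Type*} (w : T → ℝ≥0∞) (h : ℕ) :
    ∑' g : Fin h → T, ∏ i, w (g i) = (∑' t, w t) ^ h := by
  induction h with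
  | zero => simp
  | succ h ih =>
    rw [← (Fin.consEquiv fun _ : Fin (h + 1) => T).tsum_eq, ENNReal.tsum_prod']
    simp only [Fin.consEquiv, Equiv.coe_fn_mk, Fin.prod_univ_succ, Fin.cons_zero, Fin.cons_succ]
    simp_rw [ENNReal.tsum_mul_left, ih, ENNReal.tsum_mul_right]
    rw [pow_succ, mul_comm]

lemma IsMB.exists_prod_eq {h : ℕ} {A : Set ℕ} (hMB : IsMB h A) {n : ℕ} (hn : 1 ≤ n) :
    ∃ f : Fin h → ℕ, (∀ i, f i ∈ A) ∧ ∏ i, f i = n :=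
  Set.nonempty_of_ncard_ne_zero (Nat.one_le_iff_ne_zero.mp (hMB n hn))

lemma eq_one_of_squarefree_prod_of_eq {h n : ℕ} (hn : Squarefree n) {f : Fin h → ℕ}
    (hf : ∏ i, f i = n) {i j : Fin h} (hij : i ≠ j) (h_eq : f i = f j) : f i = 1 := by
  have hdvd : f i * f i ∣ n := by
    rw [← hf, ← Finset.mul_prod_erase _ _ (Finset.mem_univ i)]
    refine mul_dvd_mul_left _ ?_
    rw [h_eq]
    exact Finset.dvd_prod_of_mem _ (by simp [hij.symm])
  exact Nat.isUnit_iff.mp (hn _ hdvd)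

/-- Every squarefree integer has at least `h !` representations as a product of `h` pairwise
distinct labels, once the element `1` of the basis is duplicated `h` times. -/
lemma IsMB.factorial_mul_tsum_squarefree_le {h : ℕ} {A : Set ℕ} (hMB : IsMB h A)
    (w : ℕ →* ℝ≥0∞) :
    (h ! : ℝ≥0∞) * ∑' n : {n : ℕ // Squarefree n}, w n ≤ (∑' a : A, w a + h) ^ h := by
  classical
  let val : A ⊕ Fin h → ℕ := Sum.elim (fun a => a) (fun _ => 1)
  have hrep : ∀ n : {n : ℕ // Squarefree n}, ∃ g : Fin h → A ⊕ Fin h,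
      Function.Injective g ∧ ∏ i, val (g i) = n := by
    rintro ⟨n, hn⟩
    obtain ⟨f, hfA, hf⟩ := hMB.exists_prod_eq (Nat.one_le_iff_ne_zero.mpr hn.ne_zero)
    refine ⟨fun i => if f i = 1 then .inr i else .inl ⟨f i, hfA i⟩, fun i j hij => ?_, ?_⟩
    · by_contra hne
      by_cases hi : f i = 1 <;> by_cases hj : f j = 1 <;> simp [hi, hj] at hij
      · exact hne hij
      · exact hi (eq_one_of_squarefree_prod_of_eq hn hf hne hij)
    · refine (Finset.prod_congr rfl fun i _ => ?_).trans hf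
      by_cases hi : f i = 1 <;> simp [val, hi]
  choose g hg_inj hg_prod using hrep
  let Φ : {n : ℕ // Squarefree n} × Equiv.Perm (Fin h) → (Fin h → A ⊕ Fin h) :=
    fun p => g p.1 ∘ p.2
  have hΦ_prod : ∀ p, ∏ i, val (Φ p i) = p.1 := fun p => by
    rw [← hg_prod p.1]
    exact Equiv.prod_comp p.2 fun i => val (g p.1 i)
  have hΦ : Function.Injective Φ := by
    rintro ⟨m, σ⟩ ⟨n, τ⟩ hp
    obtain rfl : m = n := Subtype.ext (by rw [← hΦ_prod (m, σ), hp, hΦ_prod])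
    refine Prod.ext rfl (Equiv.ext fun i => hg_inj m (congrFun hp i))
  calc (h ! : ℝ≥0∞) * ∑' n : {n : ℕ // Squarefree n}, w n
      = ∑' p : {n : ℕ // Squarefree n} × Equiv.Perm (Fin h), w p.1 := by
        simp [ENNReal.tsum_prod', ENNReal.tsum_mul_left, Fintype.card_perm]
    _ = ∑' p, ∏ i, w (val (Φ p i)) :=
        tsum_congr fun p => by rw [← map_prod, hΦ_prod]
    _ ≤ ∑' q : Fin h → A ⊕ Fin h, ∏ i, w (val (q i)) :=
        ENNReal.tsum_comp_le_tsum_of_injective hΦ fun q => ∏ i, w (val (q i))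
    _ = (∑' t, w (val t)) ^ h := tsum_prod_fin_eq_pow (fun t => w (val t)) h
    _ = (∑' a : A, w a + h) ^ h := by
        rw [ENNReal.summable.tsum_sum ENNReal.summable]
        simp [val]

lemma tsum_le_tsum_squarefree_mul (w : ℕ →* ℝ≥0∞) :
    ∑' n, w n ≤ (∑' n : {n : ℕ // Squarefree n}, w n) * ∑' b, w b ^ 2 := by
  choose a b hab ha using Nat.sq_mul_squarefree
  let Φ : ℕ → {n : ℕ // Squarefree n} × ℕ := fun n => (⟨a n, ha n⟩, b n)
  have hΦ : Function.Injective Φ := fun m n hmn => by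
    simp only [Φ, Prod.mk.injEq, Subtype.mk.injEq] at hmn
    rw [← hab m, ← hab n, hmn.1, hmn.2]
  calc ∑' n, w n = ∑' n, w (Φ n).1 * w (Φ n).2 ^ 2 :=
        tsum_congr fun n => by
          conv_lhs => rw [← hab n, map_mul, map_pow, mul_comm]
    _ ≤ ∑' p : {n : ℕ // Squarefree n} × ℕ, w p.1 * w p.2 ^ 2 :=
        ENNReal.tsum_comp_le_tsum_of_injective hΦ fun p => w p.1 * w p.2 ^ 2
    _ = _ := by simp_rw [ENNReal.tsum_prod', ENNReal.tsum_mul_left, ENNReal.tsum_mul_right]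

/-- The completely multiplicative function `n ↦ n ^ (-s)` with extended nonnegative values. -/
noncomputable def dirichletWeight (s : ℝ) : ℕ →* ℝ≥0∞ where
  toFun n := ENNReal.ofReal ((n : ℝ) ^ (-s))
  map_one' := by simp
  map_mul' m n := by
    rw [← ENNReal.ofReal_mul (by positivity), Nat.cast_mul,
      Real.mul_rpow (by positivity) (by positivity)]

lemma dirichletWeight_apply (s : ℝ) (n : ℕ) :
    dirichletWeight s n = ENNReal.ofReal ((n : ℝ) ^ (-s)) := rfl

lemma tsum_dirichletWeight {s : ℝ} (hs : 1 < s) :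
    ∑' n, dirichletWeight s n = ENNReal.ofReal (∑' n : ℕ, 1 / (n : ℝ) ^ s) := by
  rw [ENNReal.ofReal_tsum_of_nonneg (fun n => by positivity)
    (Real.summable_one_div_nat_rpow.mpr hs)]
  refine tsum_congr fun n => ?_
  rw [dirichletWeight_apply, Real.rpow_neg (by positivity), one_div]

lemma tsum_dirichletWeight_sq_le {s : ℝ} (hs : 1 < s) :
    ∑' n, dirichletWeight s n ^ 2 ≤ ENNReal.ofReal (5 / 3) := by
  have hpi : π ^ 2 / 6 ≤ 5 / 3 := by nlinarith [Real.pi_lt_d2, Real.pi_pos]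
  refine le_trans ?_ (ENNReal.ofReal_le_ofReal hpi)
  rw [← hasSum_zeta_two.tsum_eq, ENNReal.ofReal_tsum_of_nonneg (fun n => by positivity)
    hasSum_zeta_two.summable]
  refine ENNReal.tsum_le_tsum fun n => ?_
  rw [dirichletWeight_apply, ← ENNReal.ofReal_pow (by positivity)]
  refine ENNReal.ofReal_le_ofReal ?_
  rcases Nat.eq_zero_or_pos n with rfl | hn
  · simp [Real.zero_rpow (by linarith : -s ≠ 0)]
  · have h1 : (1 : ℝ) ≤ n := by exact_mod_cast hn
    have h2 : (n : ℝ) ^ (-s) ≤ (n : ℝ)⁻¹ := by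
      rw [← Real.rpow_neg_one]
      exact Real.rpow_le_rpow_of_exponent_le h1 (by linarith)
    calc ((n : ℝ) ^ (-s)) ^ 2 ≤ ((n : ℝ)⁻¹) ^ 2 := by gcongr
      _ = 1 / (n : ℝ) ^ 2 := by rw [inv_pow, one_div]

lemma lintegral_mul_exp_neg_mul_Ioi {s : ℝ} (hs : 0 < s) (c : ℝ) :
    ∫⁻ u in Ioi c, ENNReal.ofReal (s * exp (-s * u)) = ENNReal.ofReal (exp (-s * c)) := by
  rw [← ofReal_integral_eq_lintegral_ofReal
    ((integrableOn_exp_mul_Ioi (neg_lt_zero.mpr hs) c).const_mul s)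
    (ae_of_all _ fun u => by positivity), integral_const_mul,
    integral_exp_mul_Ioi (neg_lt_zero.mpr hs)]
  congr 1
  field_simp

lemma dirichletWeight_eq_lintegral {s : ℝ} (hs : 0 < s) {n : ℕ} (hn : n ≠ 0) :
    dirichletWeight s n = ∫⁻ u in Ioi (0 : ℝ),
      (Ioi (Real.log n)).indicator (fun u => ENNReal.ofReal (s * exp (-s * u))) u := by
  have hn' : (0 : ℝ) < n := by positivity
  rw [setLIntegral_indicator measurableSet_Ioi,
    inter_eq_left.mpr (Ioi_subset_Ioi (Real.log_natCast_nonneg n)),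
    lintegral_mul_exp_neg_mul_Ioi hs, dirichletWeight_apply, Real.rpow_def_of_pos hn', mul_comm]

lemma tsum_subtype_indicator_le_cntF_mul {A : Set ℕ} (hA0 : 0 ∉ A) (u : ℝ) (c : ℝ≥0∞) :
    ∑' a : A, (Ioi (Real.log a)).indicator (fun _ => c) u ≤ cntF A (exp u) * c := by
  have hfin : (A ∩ Icc 1 ⌊exp u⌋₊).Finite := (finite_Icc _ _).inter_of_right _
  calc ∑' a : A, (Ioi (Real.log a)).indicator (fun _ => c) u
      ≤ ∑' a : A, (A ∩ Icc 1 ⌊exp u⌋₊).indicator (fun _ => c) a := by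
        refine ENNReal.tsum_le_tsum fun a => ?_
        by_cases hu : u ∈ Ioi (Real.log a)
        · have ha : (a : ℕ) ≠ 0 := fun h0 => hA0 (h0 ▸ a.2)
          have ha' : (0 : ℝ) < (a : ℕ) := by positivity
          have hmem : (a : ℕ) ∈ A ∩ Icc 1 ⌊exp u⌋₊ :=
            ⟨a.2, Nat.one_le_iff_ne_zero.mpr ha,
              Nat.le_floor ((Real.log_le_iff_le_exp ha').mp (le_of_lt hu))⟩
          rw [indicator_of_mem hu, indicator_of_mem hmem]
        · simp [indicator_of_notMem hu]
    _ ≤ ∑' n, (A ∩ Icc 1 ⌊exp u⌋₊).indicator (fun _ => c) n :=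
        ENNReal.tsum_comp_le_tsum_of_injective Subtype.val_injective _
    _ = cntF A (exp u) * c := by
        rw [← tsum_subtype, ENNReal.tsum_set_const, ← hfin.cast_ncard_eq]
        rfl

lemma cntF_mono (A : Set ℕ) : Monotone (cntF A) := fun _ _ hxy =>
  ncard_le_ncard (inter_subset_inter_right _ (Icc_subset_Icc_right (Nat.floor_mono hxy)))
    ((finite_Icc _ _).inter_of_right _)

lemma tsum_dirichletWeight_le_lintegral {A : Set ℕ} (hA0 : 0 ∉ A) {s : ℝ} (hs : 0 < s) :
    ∑' a : A, dirichletWeight s a ≤ ∫⁻ u in Ioi (0 : ℝ),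
      cntF A (exp u) * ENNReal.ofReal (s * exp (-s * u)) := by
  have hmeas : Measurable fun u : ℝ => ENNReal.ofReal (s * exp (-s * u)) := by fun_prop
  calc ∑' a : A, dirichletWeight s a
      = ∑' a : A, ∫⁻ u in Ioi (0 : ℝ),
          (Ioi (Real.log a)).indicator (fun u => ENNReal.ofReal (s * exp (-s * u))) u :=
        tsum_congr fun a => dirichletWeight_eq_lintegral hs fun h0 => hA0 (h0 ▸ a.2)
    _ = ∫⁻ u in Ioi (0 : ℝ), ∑' a : A,
          (Ioi (Real.log a)).indicator (fun u => ENNReal.ofReal (s * exp (-s * u))) u :=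
        (lintegral_tsum fun a => (hmeas.indicator measurableSet_Ioi).aemeasurable).symm
    _ ≤ _ := lintegral_mono fun u =>
        tsum_subtype_indicator_le_cntF_mul hA0 u (ENNReal.ofReal (s * exp (-s * u)))

lemma lintegral_rpow_mul_exp_neg_mul_Ioi {a r : ℝ} (ha : 0 < a) (hr : 0 < r) :
    ∫⁻ u in Ioi (0 : ℝ), ENNReal.ofReal (u ^ (a - 1) * exp (-(r * u))) =
      ENNReal.ofReal ((1 / r) ^ a * Gamma a) := by
  rw [← integral_rpow_mul_exp_neg_mul_Ioi ha hr, ofReal_integral_eq_lintegral_ofReal]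
  · have := integrableOn_rpow_mul_exp_neg_mul_rpow (p := 1) (by linarith : -1 < a - 1) one_pos hr
    simp only [Real.rpow_one, neg_mul] at this
    exact this
  · exact (ae_restrict_mem measurableSet_Ioi).mono fun u (hu : 0 < u) => by
      simp only [Pi.zero_apply]; positivity

/-- An Abelian estimate: a pointwise bound for the counting function of `A` yields a bound for
the Dirichlet series of `A` near its abscissa. -/
lemma tsum_dirichletWeight_le {A : Set ℕ} (hA0 : 0 ∉ A) {s a C U : ℝ} (hs : 1 < s) (ha : 0 < a)
    (hC : 0 ≤ C) (hU : ∀ u, U < u → 0 < u → (cntF A (exp u) : ℝ) ≤ C * exp u * u ^ (a - 1)) :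
    ∑' n : A, dirichletWeight s n ≤
      ENNReal.ofReal (cntF A (exp U) + C * s * ((1 / (s - 1)) ^ a * Gamma a)) := by
  have hs0 : 0 < s := by linarith
  have hs1 : 0 < s - 1 := by linarith
  have hΓ : 0 < Gamma a := Gamma_pos_of_pos ha
  have hmeas : Measurable fun u : ℝ => ENNReal.ofReal (s * exp (-s * u)) := by fun_prop
  have hmeas' : Measurable fun u : ℝ =>
      ENNReal.ofReal (u ^ (a - 1) * exp (-((s - 1) * u))) := by fun_prop
  have key : ∀ u ∈ Ioi (0 : ℝ), cntF A (exp u) * ENNReal.ofReal (s * exp (-s * u)) ≤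
      cntF A (exp U) * ENNReal.ofReal (s * exp (-s * u)) +
        ENNReal.ofReal (C * s) * ENNReal.ofReal (u ^ (a - 1) * exp (-((s - 1) * u))) := by
    intro u (hu : 0 < u)
    rcases le_or_gt u U with hle | hlt
    · refine le_add_right ?_
      gcongr
      exact cntF_mono A (exp_le_exp.mpr hle)
    · refine le_add_left ?_
      rw [← ENNReal.ofReal_natCast, ← ENNReal.ofReal_mul (by positivity),
        ← ENNReal.ofReal_mul (by positivity)]
      refine ENNReal.ofReal_le_ofReal ?_
      calc (cntF A (exp u) : ℝ) * (s * exp (-s * u))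
          ≤ C * exp u * u ^ (a - 1) * (s * exp (-s * u)) := by gcongr; exact hU u hlt hu
        _ = C * s * (u ^ (a - 1) * (exp u * exp (-s * u))) := by ring
        _ = C * s * (u ^ (a - 1) * exp (-((s - 1) * u))) := by
          rw [← Real.exp_add]; ring_nf
  calc ∑' n : A, dirichletWeight s n
      ≤ ∫⁻ u in Ioi (0 : ℝ), cntF A (exp u) * ENNReal.ofReal (s * exp (-s * u)) :=
        tsum_dirichletWeight_le_lintegral hA0 hs0
    _ ≤ ∫⁻ u in Ioi (0 : ℝ), (cntF A (exp U) * ENNReal.ofReal (s * exp (-s * u)) +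
        ENNReal.ofReal (C * s) * ENNReal.ofReal (u ^ (a - 1) * exp (-((s - 1) * u)))) :=
        setLIntegral_mono (by fun_prop) key
    _ = ENNReal.ofReal (cntF A (exp U) + C * s * ((1 / (s - 1)) ^ a * Gamma a)) := by
        rw [lintegral_add_left (hmeas.const_mul _), lintegral_const_mul _ hmeas,
          lintegral_const_mul _ hmeas', lintegral_mul_exp_neg_mul_Ioi hs0,
          lintegral_rpow_mul_exp_neg_mul_Ioi ha hs1, ← ENNReal.ofReal_natCast,
          ← ENNReal.ofReal_mul (by positivity), ← ENNReal.ofReal_mul (by positivity),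
          ← ENNReal.ofReal_add (by positivity) (by positivity)]
        simp

lemma Gamma_one_div_le {h : ℝ} (hh : 1 ≤ h) : Gamma (1 / h) ≤ h := by
  have h0 : 0 < h := by linarith
  have hle : 1 / h ≤ 1 := by rw [div_le_one h0]; exact hh
  have hconv := convexOn_Gamma.2 (mem_Ioi.mpr one_pos) (mem_Ioi.mpr two_pos)
    (sub_nonneg.mpr hle) (by positivity : 0 ≤ 1 / h) (by ring)
  have hadd : (1 - 1 / h) • (1 : ℝ) + (1 / h) • (2 : ℝ) = 1 / h + 1 := by
    simp only [smul_eq_mul]; ring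
  rw [hadd, Gamma_add_one (by positivity), Gamma_one, Gamma_two] at hconv
  simp only [smul_eq_mul, mul_one, sub_add_cancel] at hconv
  rwa [div_mul_eq_mul_div, one_mul, div_le_one h0] at hconv

lemma pow_lt_factorial {h : ℕ} (hh : 2 ≤ h) :
    5 / 3 * ((exp 1)⁻¹ * (h : ℝ)) ^ h < (h ! : ℝ) := by
  have h2 : (2 : ℝ) ≤ h := by exact_mod_cast hh
  have hsqrt : 5 / 3 < √(2 * π * h) := by
    rw [Real.lt_sqrt (by norm_num)]
    nlinarith [Real.pi_gt_three]
  refine lt_of_lt_of_le ?_ (Stirling.le_factorial_stirling h)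
  rw [inv_mul_eq_div]
  gcongr

/-- The growth forced on the counting function of a basis, in the form of a lower bound for any
constant `C` with `A(x) ≤ C x (log x)^(1/h - 1)` for large `x`. -/
lemma IsMB.factorial_le {h : ℕ} (hh : 1 ≤ h) {A : Set ℕ} (hA0 : 0 ∉ A) (hMB : IsMB h A) {C U : ℝ}
    (hC : 0 ≤ C)
    (hU : ∀ u, U < u → 0 < u → (cntF A (exp u) : ℝ) ≤ C * exp u * u ^ (1 / (h : ℝ) - 1)) :
    (h ! : ℝ) ≤ 5 / 3 * (C * h) ^ h := by
  have h1 : (1 : ℝ) ≤ h := by exact_mod_cast hh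
  have h0 : (0 : ℝ) < h := by linarith
  set K : ℝ := cntF A (exp U) + h
  have bound : ∀ s : ℝ, 1 < s → (h ! : ℝ) * ((s - 1) * ∑' n : ℕ, 1 / (n : ℝ) ^ s) ≤
      5 / 3 * (K * (s - 1) ^ (1 / (h : ℝ)) + C * s * h) ^ h := by
    intro s hs
    have hs1 : 0 < s - 1 := by linarith
    set Z : ℝ := ∑' n : ℕ, 1 / (n : ℝ) ^ s
    set F : ℝ := K + C * s * ((1 / (s - 1)) ^ (1 / (h : ℝ)) * h)
    have hF0 : 0 ≤ F := by positivity
    have hF : ∑' a : A, dirichletWeight s a + h ≤ ENNReal.ofReal F := by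
      calc ∑' a : A, dirichletWeight s a + h
          ≤ ENNReal.ofReal (cntF A (exp U) +
              C * s * ((1 / (s - 1)) ^ (1 / (h : ℝ)) * h)) + ENNReal.ofReal h := by
            rw [ENNReal.ofReal_natCast]
            gcongr
            refine (tsum_dirichletWeight_le hA0 hs (by positivity) hC hU).trans ?_
            gcongr
            exact Gamma_one_div_le h1
        _ = ENNReal.ofReal F := by
            rw [← ENNReal.ofReal_add (by positivity) (by positivity)]
            congr 1
            simp only [F, K]
            ring
    have hZ : (h ! : ℝ) * Z ≤ 5 / 3 * F ^ h := by
      rw [← ENNReal.ofReal_le_ofReal_iff (by positivity), ENNReal.ofReal_mul (by positivity),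
        ENNReal.ofReal_natCast, ← tsum_dirichletWeight hs]
      calc (h ! : ℝ≥0∞) * ∑' n, dirichletWeight s n
          ≤ h ! * ((∑' n : {n : ℕ // Squarefree n}, dirichletWeight s n) *
              ENNReal.ofReal (5 / 3)) := by
            gcongr
            refine (tsum_le_tsum_squarefree_mul _).trans ?_
            gcongr
            exact tsum_dirichletWeight_sq_le hs
        _ = ENNReal.ofReal (5 / 3) *
              (h ! * ∑' n : {n : ℕ // Squarefree n}, dirichletWeight s n) := by ring
        _ ≤ ENNReal.ofReal (5 / 3) * ENNReal.ofReal F ^ h := by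
            gcongr
            refine (hMB.factorial_mul_tsum_squarefree_le _).trans ?_
            gcongr
        _ = ENNReal.ofReal (5 / 3 * F ^ h) := by
            rw [ENNReal.ofReal_mul (by positivity), ENNReal.ofReal_pow hF0]
    have hpow : ((s - 1) ^ (1 / (h : ℝ))) ^ h = s - 1 := by
      rw [one_div]
      exact Real.rpow_inv_natCast_pow hs1.le (by omega)
    have hcancel : (s - 1) ^ (1 / (h : ℝ)) * (1 / (s - 1)) ^ (1 / (h : ℝ)) = 1 := by
      rw [← Real.mul_rpow hs1.le (by positivity), mul_one_div_cancel hs1.ne', Real.one_rpow]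
    calc (h ! : ℝ) * ((s - 1) * Z) = (s - 1) * (h ! * Z) := by ring
      _ ≤ (s - 1) * (5 / 3 * F ^ h) := by gcongr
      _ = 5 / 3 * ((s - 1) ^ (1 / (h : ℝ)) * F) ^ h := by rw [mul_pow, hpow]; ring
      _ = 5 / 3 * (K * (s - 1) ^ (1 / (h : ℝ)) + C * s * h) ^ h := by
        congr 2
        simp only [F]
        linear_combination (C * s * h) * hcancel
  have hlim_left := tendsto_sub_mul_tsum_nat_rpow.const_mul (h ! : ℝ)
  have hcont : Continuous fun s : ℝ =>
      5 / 3 * (K * (s - 1) ^ (1 / (h : ℝ)) + C * s * h) ^ h := by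
    have := Real.continuous_rpow_const (q := 1 / (h : ℝ)) (by positivity)
    have h_sub : Continuous fun s : ℝ => (s - 1) ^ (1 / (h : ℝ)) :=
      this.comp (continuous_id.sub continuous_const)
    fun_prop
  have hlim_right := (hcont.tendsto 1).mono_left (nhdsWithin_le_nhds (s := Ioi (1 : ℝ)))
  have hle := le_of_tendsto_of_tendsto hlim_left hlim_right
    (eventually_nhdsWithin_of_forall bound)
  rwa [mul_one, sub_self, Real.zero_rpow (by positivity), mul_zero, zero_add, mul_one] at hle

theorem stmt1 (h : ℕ) (hh : 2 ≤ h) (A : Set ℕ) (hA0 : 0 ∉ A) (hMB : IsMB h A) :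
    (((Real.exp 1)⁻¹ : ℝ) : EReal) <
      Filter.limsup (fun x : ℝ =>
        (((cntF A x : ℝ) * Real.log x ^ (1 - 1 / (h : ℝ)) / x : ℝ) : EReal))
        Filter.atTop := by
  by_contra! hlim
  have hcont : Continuous fun C : ℝ => 5 / 3 * (C * (h : ℝ)) ^ h := by fun_prop
  obtain ⟨C, hC_lt, hC⟩ : ∃ C : ℝ, 5 / 3 * (C * (h : ℝ)) ^ h < (h ! : ℝ) ∧ (exp 1)⁻¹ < C :=
    ((((hcont.tendsto _).eventually_lt_const (pow_lt_factorial hh)).filter_mono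
      nhdsWithin_le_nhds).and self_mem_nhdsWithin).exists (f := nhdsWithin _ (Ioi (exp 1)⁻¹))
  have hev := eventually_lt_of_limsup_lt (hlim.trans_lt (EReal.coe_lt_coe_iff.mpr hC))
  obtain ⟨U, hU⟩ := eventually_atTop.mp (tendsto_exp_atTop.eventually hev)
  have hC0 : 0 ≤ C := le_trans (by positivity) hC.le
  refine absurd (hMB.factorial_le (by omega) hA0 hC0 (U := U) fun u hu hu0 => ?_) hC_lt.not_ge
  have hlt := EReal.coe_lt_coe_iff.mp (hU u hu.le)
  rw [Real.log_exp, div_lt_iff₀ (exp_pos u)] at hlt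
  have hinv : u ^ (1 - 1 / (h : ℝ)) * u ^ (1 / (h : ℝ) - 1) = 1 := by
    rw [← Real.rpow_add hu0]
    simp
  calc (cntF A (exp u) : ℝ)
      = cntF A (exp u) * u ^ (1 - 1 / (h : ℝ)) * u ^ (1 / (h : ℝ) - 1) := by
        rw [mul_assoc, hinv, mul_one]
    _ ≤ C * exp u * u ^ (1 / (h : ℝ) - 1) := by gcongr
end

section
/- Let h ∈ ℤ⁺ and let (A_1,…,A_h) be a multiplicative complement of order h (i.e., (A_1,…,A_h) ∈ MC_h). Let τ_1,…,τ_h ∈ (0,1) with τ_1 + ⋯ + τ_h = 1, and assume limsup_{x→∞} A_i(x) · (log x)^{1-τ_i} / x < ∞ for every 1 ≤ i ≤ h. Then ∏_{i=1}^h (1/Γ(τ_i)) ≤ ∏_{i=1}^h limsup_{x→∞} A_i(x) · (log x)^{1-τ_i} / x. -/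
open Filter Real

/-- Common multiplicative representation function. -/
noncomputable def mulRepFam (h : ℕ) (A : Fin h → Set ℕ) (n : ℕ) : ℕ :=
  {f : Fin h → ℕ | (∀ i, f i ∈ A i) ∧ ∏ i, f i = n}.ncard

/-- `(A_1,…,A_h)` is a multiplicative complement of order `h`. -/
def IsMC (h : ℕ) (A : Fin h → Set ℕ) : Prop := ∀ n : ℕ, 1 ≤ n → 1 ≤ mulRepFam h A n

open MeasureTheory Topology

lemma IsMC.exists_factorization {h : ℕ} {A : Fin h → Set ℕ} (hMC : IsMC h A) {n : ℕ}
    (hn : 1 ≤ n) : ∃ f : Fin h → ℕ, (∀ i, f i ∈ A i) ∧ ∏ i, f i = n := by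
  have h1 := hMC n hn
  unfold mulRepFam at h1
  exact Set.nonempty_of_ncard_ne_zero (Nat.one_le_iff_ne_zero.1 h1)

/-- The partial zeta sums are bounded by products of partial Dirichlet sums over the `A i`. -/
lemma IsMC.sum_rpow_le_prod {h : ℕ} {A : Fin h → Set ℕ} (hMC : IsMC h A) (s : ℝ) (N : ℕ) :
    open Classical in
    ∑ n ∈ Finset.Icc 1 N, (n : ℝ) ^ (-s)
      ≤ ∏ i, ∑ a ∈ Finset.Icc 1 N with a ∈ A i, (a : ℝ) ^ (-s) := by
  classical
  choose! f hfA hfprod using fun n (hn : 1 ≤ n) => hMC.exists_factorization hn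
  rw [Finset.prod_univ_sum]
  have hinj : Set.InjOn f (Finset.Icc 1 N : Finset ℕ) := by
    intro a ha b hb hab
    simp only [Finset.coe_Icc, Set.mem_Icc] at ha hb
    rw [← hfprod a ha.1, ← hfprod b hb.1, hab]
  calc ∑ n ∈ Finset.Icc 1 N, (n : ℝ) ^ (-s)
      = ∑ n ∈ Finset.Icc 1 N, ∏ i, (f n i : ℝ) ^ (-s) := by
        refine Finset.sum_congr rfl fun n hn => ?_
        rw [Real.finsetProd_rpow _ _ fun i _ => Nat.cast_nonneg _, ← Nat.cast_prod,
          hfprod n (Finset.mem_Icc.1 hn).1]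
    _ = ∑ p ∈ (Finset.Icc 1 N).image f, ∏ i, (p i : ℝ) ^ (-s) :=
        (Finset.sum_image (f := fun p : Fin h → ℕ => ∏ i, (p i : ℝ) ^ (-s)) hinj).symm
    _ ≤ _ := by
        refine Finset.sum_le_sum_of_subset_of_nonneg ?_ fun p _ _ =>
          Finset.prod_nonneg fun i _ => by positivity
        intro p hp
        obtain ⟨n, hn, rfl⟩ := Finset.mem_image.1 hp
        obtain ⟨hn1, hnN⟩ := Finset.mem_Icc.1 hn
        rw [Fintype.mem_piFinset]
        intro i
        have hdvd : f n i ∣ n :=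
          (Finset.dvd_prod_of_mem (f n) (Finset.mem_univ i)).trans (hfprod n hn1).dvd
        exact Finset.mem_filter.2 ⟨Finset.mem_Icc.2 ⟨Nat.pos_of_dvd_of_pos hdvd hn1,
          (Nat.le_of_dvd hn1 hdvd).trans hnN⟩, hfA n hn1 i⟩

lemma cntF_le_self (A : Set ℕ) {x : ℝ} (hx : 0 ≤ x) : (cntF A x : ℝ) ≤ x := by
  have h1 : cntF A x ≤ ⌊x⌋₊ := by
    refine (Set.ncard_le_ncard Set.inter_subset_right (Set.finite_Icc _ _)).trans ?_
    simp
  exact (Nat.cast_le.2 h1).trans (Nat.floor_le hx)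

lemma exists_cntF_exp_le {A : Set ℕ} {τ c : ℝ} (hc : 0 ≤ c)
    (hev : ∀ᶠ x : ℝ in atTop, (cntF A x : ℝ) * log x ^ (1 - τ) / x ≤ c) :
    ∃ X : ℝ, 0 ≤ X ∧ ∀ u : ℝ, 0 < u → (cntF A (exp u) : ℝ) ≤ X + c * exp u * u ^ (τ - 1) := by
  obtain ⟨X, hX⟩ := eventually_atTop.1 hev
  refine ⟨max X 0, le_max_right _ _, fun u hu => ?_⟩
  have hpos : 0 ≤ c * exp u * u ^ (τ - 1) := by positivity
  rcases le_total X (exp u) with hle | hle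
  · have h1 := hX _ hle
    rw [log_exp, div_le_iff₀ (exp_pos u)] at h1
    have h2 : (cntF A (exp u) : ℝ) ≤ c * exp u * u ^ (τ - 1) := by
      calc (cntF A (exp u) : ℝ) = cntF A (exp u) * u ^ (1 - τ) * u ^ (τ - 1) := by
            rw [mul_assoc, ← rpow_add hu]; simp
        _ ≤ _ := by gcongr
    linarith [le_max_right X 0]
  · linarith [cntF_le_self A (exp_pos u).le, le_max_left X 0]

lemma rpow_neg_eq_setIntegral_indicator {s : ℝ} (hs : 0 < s) {a : ℕ} (ha : 1 ≤ a) :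
    (a : ℝ) ^ (-s) =
      ∫ u in Set.Ioi (0 : ℝ), (Set.Ioi (log a)).indicator (fun u => s * exp (-s * u)) u := by
  have ha' : (1 : ℝ) ≤ a := by exact_mod_cast ha
  have hlog : 0 ≤ log a := log_nonneg ha'
  rw [setIntegral_indicator measurableSet_Ioi, Set.inter_eq_right.2 (Set.Ioi_subset_Ioi hlog),
    integral_const_mul, integral_exp_mul_Ioi (by linarith), rpow_def_of_pos (by linarith)]
  field_simp

lemma sum_indicator_le_cntF (A : Set ℕ) (N : ℕ) {g : ℝ → ℝ} (hg : ∀ u, 0 ≤ g u) (u : ℝ) :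
    open Classical in
    ∑ a ∈ Finset.Icc 1 N with a ∈ A, (Set.Ioi (log a)).indicator g u
      ≤ cntF A (exp u) * g u := by
  classical
  simp only [Set.indicator_apply, Set.mem_Ioi]
  rw [← Finset.sum_filter, Finset.sum_const, nsmul_eq_mul]
  refine mul_le_mul_of_nonneg_right ?_ (hg u)
  rw [Nat.cast_le, ← Set.ncard_coe_finset]
  refine Set.ncard_le_ncard ?_ ((Set.finite_Icc _ _).inter_of_right _)
  intro a ha
  simp only [Finset.coe_filter, Finset.mem_filter, Finset.mem_Icc, Set.mem_ofPred_eq] at ha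
  obtain ⟨⟨⟨h1, -⟩, hA⟩, hlt⟩ := ha
  refine ⟨hA, h1, Nat.le_floor ?_⟩
  exact ((log_lt_iff_lt_exp (by exact_mod_cast h1)).1 hlt).le

/-- Laplace-transform bound for the partial Dirichlet sums over a set of controlled counting
function. -/
lemma sum_rpow_neg_le {A : Set ℕ} {τ c X : ℝ} (hτ : 0 < τ)
    (hX : ∀ u : ℝ, 0 < u → (cntF A (exp u) : ℝ) ≤ X + c * exp u * u ^ (τ - 1))
    {s : ℝ} (hs : 1 < s) (N : ℕ) :
    open Classical in
    ∑ a ∈ Finset.Icc 1 N with a ∈ A, (a : ℝ) ^ (-s)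
      ≤ X + s * c * Gamma τ * (s - 1) ^ (-τ) := by
  classical
  have hs0 : 0 < s := by linarith
  have hs1 : 0 < s - 1 := by linarith
  have hexp : IntegrableOn (fun u => s * exp (-s * u)) (Set.Ioi 0) :=
    (integrableOn_exp_mul_Ioi (by linarith) 0).const_mul s
  have hgam : IntegrableOn (fun u : ℝ => u ^ (τ - 1) * exp (-((s - 1) * u))) (Set.Ioi 0) := by
    refine .of_integral_ne_zero ?_
    rw [integral_rpow_mul_exp_neg_mul_Ioi hτ hs1]
    have := Gamma_pos_of_pos hτ
    positivity
  have hind : ∀ a : ℕ, IntegrableOn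
      ((Set.Ioi (log a)).indicator (fun u => s * exp (-s * u))) (Set.Ioi 0) :=
    fun a => Integrable.indicator hexp measurableSet_Ioi
  calc ∑ a ∈ Finset.Icc 1 N with a ∈ A, (a : ℝ) ^ (-s)
      = ∑ a ∈ Finset.Icc 1 N with a ∈ A, ∫ u in Set.Ioi (0 : ℝ),
          (Set.Ioi (log a)).indicator (fun u => s * exp (-s * u)) u :=
        Finset.sum_congr rfl fun a ha => rpow_neg_eq_setIntegral_indicator hs0
          (Finset.mem_Icc.1 (Finset.mem_filter.1 ha).1).1
    _ = ∫ u in Set.Ioi (0 : ℝ), ∑ a ∈ Finset.Icc 1 N with a ∈ A,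
          (Set.Ioi (log a)).indicator (fun u => s * exp (-s * u)) u :=
        (integral_finsetSum _ fun a _ => hind a).symm
    _ ≤ ∫ u in Set.Ioi (0 : ℝ), (X * (s * exp (-s * u))
          + s * c * (u ^ (τ - 1) * exp (-((s - 1) * u)))) := by
        refine setIntegral_mono_on (integrable_finsetSum _ fun a _ => hind a)
          ((hexp.const_mul X).add (hgam.const_mul (s * c))) measurableSet_Ioi fun u hu => ?_
        refine (sum_indicator_le_cntF A N (fun u => by positivity) u).trans ?_
        refine (mul_le_mul_of_nonneg_right (hX u hu) (by positivity)).trans (le_of_eq ?_)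
        have : exp (-((s - 1) * u)) = exp u * exp (-s * u) := by
          rw [← exp_add]; ring_nf
        rw [this]; ring
    _ = X + s * c * Gamma τ * (s - 1) ^ (-τ) := by
        rw [integral_add (hexp.const_mul X) (hgam.const_mul (s * c)), integral_const_mul,
          integral_const_mul, integral_const_mul, integral_exp_mul_Ioi (by linarith),
          integral_rpow_mul_exp_neg_mul_Ioi hτ hs1, one_div, inv_rpow hs1.le, rpow_neg hs1.le]
        simp only [mul_zero, exp_zero]
        field_simp

lemma IsMC.one_le_prod_mul_Gamma {h : ℕ} {A : Fin h → Set ℕ} (hMC : IsMC h A)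
    {τ c : Fin h → ℝ} (hτ : ∀ i, 0 < τ i) (hsum : ∑ i, τ i = 1) (hc : ∀ i, 0 ≤ c i)
    (hev : ∀ i, ∀ᶠ x : ℝ in atTop, (cntF (A i) x : ℝ) * log x ^ (1 - τ i) / x ≤ c i) :
    1 ≤ ∏ i, (c i * Gamma (τ i)) := by
  classical
  choose X hX0 hX using fun i => exists_cntF_exp_le (hc i) (hev i)
  have hzeta : ∀ s : ℝ, 1 < s → (s - 1) * ∑' n : ℕ, 1 / (n : ℝ) ^ s
      ≤ ∏ i, (X i * (s - 1) ^ τ i + s * c i * Gamma (τ i)) := by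
    intro s hs
    have hs1 : 0 < s - 1 := by linarith
    have hle : ∑' n : ℕ, 1 / (n : ℝ) ^ s
        ≤ ∏ i, (X i + s * c i * Gamma (τ i) * (s - 1) ^ (-τ i)) := by
      refine Real.tsum_le_of_sum_range_le (fun n => by positivity) fun N => ?_
      calc ∑ n ∈ Finset.range N, 1 / (n : ℝ) ^ s
          ≤ ∑ n ∈ Finset.Icc 1 N, (n : ℝ) ^ (-s) := by
            rw [← Finset.sum_subset (s₁ := (Finset.range N).erase 0) (Finset.erase_subset _ _)]
            · simp only [one_div, ← rpow_neg (Nat.cast_nonneg _)]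
              refine Finset.sum_le_sum_of_subset_of_nonneg ?_ fun n _ _ => by positivity
              intro n hn
              simp only [Finset.mem_erase, Finset.mem_range, Finset.mem_Icc] at hn ⊢
              omega
            · intro n hn hn'
              have : n = 0 := by
                by_contra h0
                exact hn' (Finset.mem_erase.2 ⟨h0, hn⟩)
              simp [this, zero_rpow (by linarith : s ≠ 0)]
        _ ≤ ∏ i, ∑ a ∈ Finset.Icc 1 N with a ∈ A i, (a : ℝ) ^ (-s) :=
            hMC.sum_rpow_le_prod s N
        _ ≤ _ := Finset.prod_le_prod (fun i _ => Finset.sum_nonneg fun a _ => by positivity)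
            fun i _ => sum_rpow_neg_le (hτ i) (hX i) hs N
    calc (s - 1) * ∑' n : ℕ, 1 / (n : ℝ) ^ s
        ≤ (s - 1) * ∏ i, (X i + s * c i * Gamma (τ i) * (s - 1) ^ (-τ i)) := by gcongr
      _ = (∏ i, (s - 1) ^ τ i) * ∏ i, (X i + s * c i * Gamma (τ i) * (s - 1) ^ (-τ i)) := by
          rw [← rpow_sum_of_pos hs1, hsum, rpow_one]
      _ = _ := by
          rw [← Finset.prod_mul_distrib]
          refine Finset.prod_congr rfl fun i _ => ?_
          have : (s - 1) ^ τ i * (s - 1) ^ (-τ i) = 1 := by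
            rw [← rpow_add hs1]; simp
          linear_combination (s * c i * Gamma (τ i)) * this
  have hlim : Tendsto (fun s : ℝ => ∏ i, (X i * (s - 1) ^ τ i + s * c i * Gamma (τ i)))
      (𝓝[>] 1) (𝓝 (∏ i, (c i * Gamma (τ i)))) := by
    refine tendsto_finsetProd _ fun i _ => ?_
    have hcont : ContinuousAt (fun s : ℝ => X i * (s - 1) ^ τ i + s * c i * Gamma (τ i)) 1 := by
      have : ContinuousAt (fun s : ℝ => (s - 1) ^ τ i) 1 :=
        ContinuousAt.rpow_const (by fun_prop) (Or.inr (hτ i).le)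
      fun_prop
    have h1 := hcont.tendsto
    simp only [sub_self, zero_rpow (hτ i).ne', mul_zero, one_mul, zero_add] at h1
    exact h1.mono_left nhdsWithin_le_nhds
  refine le_of_tendsto_of_tendsto tendsto_sub_mul_tsum_nat_rpow hlim ?_
  filter_upwards [self_mem_nhdsWithin] with s hs using hzeta s hs

lemma EReal.coe_finset_prod {ι : Type*} (s : Finset ι) (f : ι → ℝ) :
    ((∏ i ∈ s, f i : ℝ) : EReal) = ∏ i ∈ s, (f i : EReal) := by
  classical
  induction s using Finset.induction_on with
  | empty => simp
  | insert a s ha ih => rw [Finset.prod_insert ha, Finset.prod_insert ha, EReal.coe_mul, ih]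

theorem stmt3 (h : ℕ) (hh : 1 ≤ h) (A : Fin h → Set ℕ) (hA0 : ∀ i, 0 ∉ A i)
    (hMC : IsMC h A)
    (τ : Fin h → ℝ) (hτ : ∀ i, τ i ∈ Set.Ioo (0 : ℝ) 1) (hsum : ∑ i, τ i = 1)
    (hfin : ∀ i, Filter.limsup (fun x : ℝ =>
      (((cntF (A i) x : ℝ) * Real.log x ^ (1 - τ i) / x : ℝ) : EReal)) Filter.atTop < ⊤) :
    ∏ i, (((Real.Gamma (τ i))⁻¹ : ℝ) : EReal)
      ≤ ∏ i, Filter.limsup (fun x : ℝ =>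
          (((cntF (A i) x : ℝ) * Real.log x ^ (1 - τ i) / x : ℝ) : EReal)) Filter.atTop := by
  have hnonneg : ∀ i, 0 ≤ limsup (fun x : ℝ =>
      (((cntF (A i) x : ℝ) * Real.log x ^ (1 - τ i) / x : ℝ) : EReal)) atTop := by
    intro i
    refine le_limsup_of_frequently_le (Eventually.frequently ?_)
    filter_upwards [eventually_ge_atTop 1] with x hx
    have := log_nonneg hx
    exact EReal.coe_nonneg.2 (by positivity)
  have hreal : ∀ i, ∃ l : ℝ, limsup (fun x : ℝ =>
      (((cntF (A i) x : ℝ) * Real.log x ^ (1 - τ i) / x : ℝ) : EReal)) atTop = l := fun i =>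
    ⟨_, (EReal.coe_toReal (hfin i).ne
      ((EReal.bot_lt_zero.trans_le (hnonneg i)).ne')).symm⟩
  choose l hl using hreal
  have hl0 : ∀ i, 0 ≤ l i := fun i => by
    have := hnonneg i
    rw [hl i] at this
    exact EReal.coe_nonneg.1 this
  simp only [hl]
  rw [← EReal.coe_finset_prod, ← EReal.coe_finset_prod, EReal.coe_le_coe_iff]
  have hε : ∀ ε : ℝ, 0 < ε → 1 ≤ ∏ i, ((l i + ε) * Gamma (τ i)) := by
    intro ε hε
    refine hMC.one_le_prod_mul_Gamma (fun i => (hτ i).1) hsum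
      (fun i => by linarith [hl0 i]) fun i => ?_
    have hlt : limsup (fun x : ℝ =>
        (((cntF (A i) x : ℝ) * Real.log x ^ (1 - τ i) / x : ℝ) : EReal)) atTop
        < ((l i + ε : ℝ) : EReal) := by
      rw [hl i, EReal.coe_lt_coe_iff]
      linarith
    filter_upwards [eventually_lt_of_limsup_lt hlt] with x hx
    exact (EReal.coe_lt_coe_iff.1 hx).le
  have hone : 1 ≤ ∏ i, (l i * Gamma (τ i)) := by
    have hcont : Continuous fun ε : ℝ => ∏ i, ((l i + ε) * Gamma (τ i)) := by fun_prop
    have h1 := hcont.tendsto 0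
    simp only [add_zero] at h1
    refine ge_of_tendsto (h1.mono_left (nhdsWithin_le_nhds (s := Set.Ioi 0))) ?_
    filter_upwards [self_mem_nhdsWithin] with ε hε' using hε ε hε'
  have hΓ : 0 < ∏ i, Gamma (τ i) :=
    Finset.prod_pos fun i _ => Gamma_pos_of_pos (hτ i).1
  rw [Finset.prod_mul_distrib] at hone
  rwa [Finset.prod_inv_distrib, inv_le_iff_one_le_mul₀ hΓ]
end
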